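/- (Weighted Sobolev estimate, eq. (5.100')/(4.2).) Let n ≥ 3, 0 < α < n, 0 < τ ≤ 1 + α/n, and p = 1 + (2 − 2τ + α)/(n − 2). Then there exists a constant C > 0 such that for every u ∈ C_c^∞(ℝⁿ, ℂ), ( ∫_{ℝⁿ} |x|^{−2nτ/(α+n)} |u(x)|^{2np/(α+n)} dx )^{(α+n)/(2np)} ≤ C ( ∫_{ℝⁿ} |∇u|² dx )^{1/2}; equivalently ‖ |x|^{−τ}|u|^p ‖_{L^{2n/(α+n)}} ≤ C ‖∇u‖_{L²}^p. -/

import Mathlib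

open MeasureTheory

/-- Integration by parts against the Euler field `x ↦ x`, whose divergence is `n`. -/
theorem integral_fderiv_apply_self {n : ℕ} {g : EuclideanSpace ℝ (Fin n) → ℝ}
    (hg : ContDiff ℝ 1 g) (hc : HasCompactSupport g) :
    ∫ x, fderiv ℝ g x x = -(n * ∫ x, g x) := by
  have hfd : Continuous (fderiv ℝ g) := hg.continuous_fderiv one_ne_zero
  have hcd : HasCompactSupport (fderiv ℝ g) := hc.fderiv ℝ
  let e : Fin n → EuclideanSpace ℝ (Fin n) := fun i => EuclideanSpace.single i 1
  have hint : ∀ i, Integrable fun x : EuclideanSpace ℝ (Fin n) => x i * fderiv ℝ g x (e i) := by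
    intro i
    refine Continuous.integrable_of_hasCompactSupport (by fun_prop) ?_
    have h : HasCompactSupport fun x => fderiv ℝ g x (e i) :=
      hcd.comp_left (g := fun L : EuclideanSpace ℝ (Fin n) →L[ℝ] ℝ => L (e i)) (by simp)
    exact h.mul_left
  have hcoord : ∀ i, ∫ x : EuclideanSpace ℝ (Fin n), x i * fderiv ℝ g x (e i) = -∫ x, g x := by
    intro i
    have hproj : ∀ x, fderiv ℝ (fun x : EuclideanSpace ℝ (Fin n) => x i) x =
        EuclideanSpace.proj i := fun x =>
      (EuclideanSpace.proj (𝕜 := ℝ) i : EuclideanSpace ℝ (Fin n) →L[ℝ] ℝ).fderiv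
    have h := integral_mul_fderiv_eq_neg_fderiv_mul_of_integrable
      (μ := (volume : Measure (EuclideanSpace ℝ (Fin n))))
      (f := fun x : EuclideanSpace ℝ (Fin n) => x i) (g := g) (v := e i)
      ?_ ?_ ?_ (fun x _ => by fun_prop) (fun x _ => hg.differentiable one_ne_zero x)
    · rw [h]
      simp [hproj, e]
    · simpa [hproj, e] using hg.continuous.integrable_of_hasCompactSupport hc
    · exact hint i
    · exact Continuous.integrable_of_hasCompactSupport (by fun_prop) hc.mul_left
  have hexp : ∀ x, fderiv ℝ g x x = ∑ i, x i * fderiv ℝ g x (e i) := by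
    intro x
    have h := congrArg (fderiv ℝ g x) ((EuclideanSpace.basisFun (Fin n) ℝ).sum_repr x)
    rw [← h]
    simp [map_sum, e]
  simp_rw [hexp]
  rw [integral_finsetSum]
  · simp [hcoord]
  · exact fun i _ => hint i

/-- Hardy's inequality with the weight `1 / |x|²` regularized to `1 / (|x|² + ε)`. -/
theorem integral_sq_div_norm_sq_add_le {n : ℕ} (hn : 3 ≤ n) {u : EuclideanSpace ℝ (Fin n) → ℂ}
    (hu : ContDiff ℝ 1 u) (hc : HasCompactSupport u) {ε : ℝ} (hε : 0 < ε) :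
    ∫ x, ‖u x‖ ^ 2 / (‖x‖ ^ 2 + ε) ≤ 4 / ((n : ℝ) - 2) ^ 2 * ∫ x, ‖fderiv ℝ u x‖ ^ 2 := by
  have hn' : (0 : ℝ) < n - 2 := by
    have : (3 : ℝ) ≤ n := by exact_mod_cast hn
    linarith
  set g : EuclideanSpace ℝ (Fin n) → ℝ := fun x => ‖u x‖ ^ 2 / (‖x‖ ^ 2 + ε)
  have hpos : ∀ x : EuclideanSpace ℝ (Fin n), 0 < ‖x‖ ^ 2 + ε := fun x => by positivity
  have hg : ContDiff ℝ 1 g :=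
    (hu.norm_sq ℝ).div ((contDiff_norm_sq ℝ).add contDiff_const) fun x => (hpos x).ne'
  have hgc : HasCompactSupport g := by
    refine hc.mono fun x hx => ?_
    contrapose! hx
    simp_all [g]
  have hgi : Integrable g := hg.continuous.integrable_of_hasCompactSupport hgc
  have hD : Integrable fun x => ‖fderiv ℝ u x‖ ^ 2 := by
    refine Continuous.integrable_of_hasCompactSupport
      ((hu.continuous_fderiv one_ne_zero).norm.pow 2) ?_
    exact (hc.fderiv ℝ).comp_left (g := fun L => ‖L‖ ^ 2) (by simp)
  have hdi : Integrable fun x => fderiv ℝ g x x := by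
    refine Continuous.integrable_of_hasCompactSupport
      ((hg.continuous_fderiv one_ne_zero).clm_apply continuous_id) ?_
    refine (hgc.fderiv ℝ).mono fun x hx => ?_
    contrapose! hx
    simp_all
  have hderiv : ∀ x, fderiv ℝ g x x = (2 * inner ℝ (u x) (fderiv ℝ u x x)) / (‖x‖ ^ 2 + ε)
      - ‖u x‖ ^ 2 * (2 * ‖x‖ ^ 2) / (‖x‖ ^ 2 + ε) ^ 2 := by
    intro x
    have h1 := (hu.differentiable one_ne_zero x).hasFDerivAt.norm_sq
    have h2 := ((hasFDerivAt_id x).norm_sq).add_const ε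
    have h3 := h2.mul (hg.differentiable one_ne_zero x).hasFDerivAt
    have hs := (hpos x).ne'
    have heq : (fun y : EuclideanSpace ℝ (Fin n) => ‖u y‖ ^ 2) =
        (fun y => ‖id y‖ ^ 2 + ε) * g := by
      ext y
      have := (hpos y).ne'
      simp only [g, id, Pi.mul_apply]
      field_simp
    rw [← heq] at h3
    have h := congrArg (fun L => L x) (h1.unique h3)
    simp only [nsmul_eq_mul, Nat.cast_ofNat, ContinuousLinearMap.coe_comp, smul_apply,
      add_apply, Function.comp_apply, innerSL_apply_apply, id, smul_eq_mul,
      ContinuousLinearMap.coe_id', real_inner_self_eq_norm_sq] at h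
    rw [show g x = ‖u x‖ ^ 2 / (‖x‖ ^ 2 + ε) from rfl] at h
    generalize fderiv ℝ g x x = G at *
    field_simp at h ⊢
    linarith
  have hpt : ∀ x, ((n : ℝ) - 2) / 2 * g x - 2 / ((n : ℝ) - 2) * ‖fderiv ℝ u x‖ ^ 2
      ≤ fderiv ℝ g x x + n * g x := by
    intro x
    rw [hderiv]
    have hp := hpos x
    have hin : -(‖u x‖ * (‖fderiv ℝ u x‖ * ‖x‖)) ≤ inner ℝ (u x) (fderiv ℝ u x x) := by
      have h1 := abs_real_inner_le_norm (u x) (fderiv ℝ u x x)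
      have h2 := (fderiv ℝ u x).le_opNorm x
      have h3 := mul_le_mul_of_nonneg_left h2 (norm_nonneg (u x))
      linarith [neg_abs_le (inner ℝ (u x) (fderiv ℝ u x x))]
    generalize inner ℝ (u x) (fderiv ℝ u x x) = I at *
    simp only [g]
    generalize ‖u x‖ = a at *
    generalize ‖fderiv ℝ u x‖ = d at *
    have hx0 : ‖x‖ ^ 2 ≤ ‖x‖ ^ 2 + ε := by linarith
    generalize ‖x‖ = r at *
    generalize r ^ 2 + ε = s at *
    obtain ⟨m, hm⟩ : ∃ m, m = (n : ℝ) - 2 := ⟨_, rfl⟩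
    rw [show (n : ℝ) = m + 2 by linarith, add_sub_cancel_right]
    rw [← hm] at hn'
    have h1 : (r / s) ^ 2 ≤ 1 / s := by
      rw [div_pow, div_le_div_iff₀ (by positivity) hp]
      nlinarith
    have h2 : -(2 * a * d * (r / s)) ≤ 2 * I / s := by
      rw [le_div_iff₀ hp]
      field_simp
      linarith
    have h3 : 2 * a * d * (r / s) ≤ 2 / m * d ^ 2 + m / 2 * a ^ 2 * (r / s) ^ 2 := by
      have : 0 ≤ 2 / m * (d - m / 2 * a * (r / s)) ^ 2 := by positivity
      have e : 2 / m * (d - m / 2 * a * (r / s)) ^ 2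
          = 2 / m * d ^ 2 + m / 2 * a ^ 2 * (r / s) ^ 2 - 2 * a * d * (r / s) := by
        generalize r / s = t
        field_simp
        ring
      linarith
    have h4 : (m / 2 * a ^ 2 + 2 * a ^ 2) * (r / s) ^ 2 ≤ (m / 2 * a ^ 2 + 2 * a ^ 2) * (1 / s) := by
      gcongr
    have e1 : a ^ 2 * (2 * r ^ 2) / s ^ 2 = 2 * a ^ 2 * (r / s) ^ 2 := by ring
    have e2 : a ^ 2 / s = a ^ 2 * (1 / s) := by ring
    rw [e1, e2]
    linarith
  have hint := integral_mono ((hgi.const_mul _).sub (hD.const_mul _))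
    (hdi.add (hgi.const_mul _)) hpt
  simp only [Pi.add_apply, Pi.sub_apply] at hint
  rw [integral_sub (hgi.const_mul _) (hD.const_mul _), integral_add hdi (hgi.const_mul _),
    integral_fderiv_apply_self hg hgc] at hint
  simp only [integral_const_mul] at hint
  have h4 : ((n : ℝ) - 2) / 2 * ∫ x, g x ≤ 2 / ((n : ℝ) - 2) * ∫ x, ‖fderiv ℝ u x‖ ^ 2 := by
    linarith
  calc ∫ x, g x = 2 / ((n : ℝ) - 2) * (((n : ℝ) - 2) / 2 * ∫ x, g x) := by field_simp
    _ ≤ 2 / ((n : ℝ) - 2) * (2 / ((n : ℝ) - 2) * ∫ x, ‖fderiv ℝ u x‖ ^ 2) := by gcongr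
    _ = _ := by field_simp; ring

/-- Hardy's inequality. -/
theorem lintegral_sq_div_norm_sq_le {n : ℕ} (hn : 3 ≤ n) {u : EuclideanSpace ℝ (Fin n) → ℂ}
    (hu : ContDiff ℝ 1 u) (hc : HasCompactSupport u) :
    ∫⁻ x, ENNReal.ofReal (‖u x‖ ^ 2 / ‖x‖ ^ 2) ≤
      ENNReal.ofReal (4 / ((n : ℝ) - 2) ^ 2 * ∫ x, ‖fderiv ℝ u x‖ ^ 2) := by
  let ε : ℕ → ℝ := fun k => 1 / ((k : ℝ) + 1)
  have hε : ∀ k, 0 < ε k := fun k => by positivity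
  have hcont : ∀ k, Continuous fun x => ‖u x‖ ^ 2 / (‖x‖ ^ 2 + ε k) := fun k =>
    (hu.continuous.norm.pow 2).div (by fun_prop) fun x => by have := hε k; positivity
  have hbound : ∀ k, ∫⁻ x, ENNReal.ofReal (‖u x‖ ^ 2 / (‖x‖ ^ 2 + ε k)) ≤
      ENNReal.ofReal (4 / ((n : ℝ) - 2) ^ 2 * ∫ x, ‖fderiv ℝ u x‖ ^ 2) := by
    intro k
    rw [← ofReal_integral_eq_lintegral_ofReal]
    · exact ENNReal.ofReal_le_ofReal (integral_sq_div_norm_sq_add_le hn hu hc (hε k))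
    · refine (hcont k).integrable_of_hasCompactSupport (hc.mono fun x hx => ?_)
      contrapose! hx
      simp_all
    · exact .of_forall fun x => by have := hε k; positivity
  calc ∫⁻ x, ENNReal.ofReal (‖u x‖ ^ 2 / ‖x‖ ^ 2)
      ≤ ∫⁻ x, Filter.liminf (fun k => ENNReal.ofReal (‖u x‖ ^ 2 / (‖x‖ ^ 2 + ε k)))
          Filter.atTop := by
        refine lintegral_mono fun x => ?_
        rcases eq_or_ne x 0 with rfl | hx
        · simp
        have hx' : ‖x‖ ^ 2 + 0 ≠ 0 := by simpa using hx
        have ht := ENNReal.tendsto_ofReal (Filter.Tendsto.div (tendsto_const_nhds (x := ‖u x‖ ^ 2))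
          ((tendsto_const_nhds (x := ‖x‖ ^ 2)).add tendsto_one_div_add_atTop_nhds_zero_nat) hx')
        rw [add_zero] at ht
        exact ht.liminf_eq.ge
    _ ≤ Filter.liminf (fun k => ∫⁻ x, ENNReal.ofReal (‖u x‖ ^ 2 / (‖x‖ ^ 2 + ε k)))
          Filter.atTop :=
        lintegral_liminf_le fun k => (hcont k).measurable.ennreal_ofReal
    _ ≤ _ := Filter.liminf_le_of_le (by isBoundedDefault) fun b hb => by
        obtain ⟨k, hk⟩ := hb.exists
        exact hk.trans (hbound k)

/-- The Sobolev inequality for the critical exponent `2n / (n - 2)`. -/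
theorem exists_lintegral_rpow_le {n : ℕ} (hn : 3 ≤ n) :
    ∃ S : ℝ, 0 ≤ S ∧ ∀ u : EuclideanSpace ℝ (Fin n) → ℂ,
      ContDiff ℝ 1 u → HasCompactSupport u →
      ∫⁻ x, ENNReal.ofReal (‖u x‖ ^ (2 * n / ((n : ℝ) - 2))) ≤
        ENNReal.ofReal (S * (∫ x, ‖fderiv ℝ u x‖ ^ 2) ^ (n / ((n : ℝ) - 2))) := by
  have hn3 : (3 : ℝ) ≤ n := by exact_mod_cast hn
  have hn' : (0 : ℝ) < n - 2 := by linarith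
  have hq0 : 0 < 2 * n / ((n : ℝ) - 2) := by positivity
  obtain ⟨q, hq⟩ : ∃ q : NNReal, (q : ℝ) = 2 * n / ((n : ℝ) - 2) := ⟨⟨_, hq0.le⟩, rfl⟩
  have hqpos : 0 < (q : ℝ) := hq ▸ hq0
  let K : NNReal := SNormLESNormFDerivOfEqConst ℂ
    (volume : Measure (EuclideanSpace ℝ (Fin n))) 2
  refine ⟨(K : ℝ) ^ (q : ℝ), by positivity, fun u hu hc => ?_⟩
  have hD : Continuous (fderiv ℝ u) := hu.continuous_fderiv one_ne_zero
  have hD0 : 0 ≤ ∫ x, ‖fderiv ℝ u x‖ ^ 2 := integral_nonneg fun x => by positivity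
  have hsob := eLpNorm_le_eLpNorm_fderiv_of_eq (F := ℂ)
    (volume : Measure (EuclideanSpace ℝ (Fin n))) hu hc (p := 2) (p' := q)
    (by norm_num) (by simp; omega) (by
      rw [hq, finrank_euclideanSpace_fin]
      have : (n : ℝ) ≠ 0 := by positivity
      push_cast
      field_simp)
  have hmem : MemLp (fderiv ℝ u) (2 : NNReal) volume :=
    hD.memLp_of_hasCompactSupport (hc.fderiv ℝ)
  rw [hmem.eLpNorm_eq_integral_rpow_norm (by simp) (by simp),
    eLpNorm_nnreal_eq_lintegral (by exact_mod_cast hqpos.ne'), one_div,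
    ENNReal.rpow_inv_le_iff hqpos] at hsob
  simp only [ENNReal.coe_toReal, NNReal.coe_ofNat, Real.rpow_ofNat] at hsob
  calc ∫⁻ x, ENNReal.ofReal (‖u x‖ ^ (2 * n / ((n : ℝ) - 2)))
      = ∫⁻ x, ‖u x‖ₑ ^ (q : ℝ) := by
        refine lintegral_congr fun x => ?_
        rw [← ENNReal.ofReal_rpow_of_nonneg (norm_nonneg _) hq0.le, ofReal_norm, hq]
    _ ≤ _ := hsob
    _ = _ := by
        rw [← ENNReal.ofReal_coe_nnreal, ← ENNReal.ofReal_mul (by positivity),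
          ENNReal.ofReal_rpow_of_nonneg (by positivity) (by positivity),
          Real.mul_rpow (by positivity) (by positivity), ← Real.rpow_mul hD0,
          show (2 : ℝ)⁻¹ * q = n / ((n : ℝ) - 2) by rw [hq]; ring]

/-- Weighted Sobolev estimate (eq. (5.100')/(4.2)):
`‖ |x|^{-τ} |u|^p ‖_{L^{2n/(α+n)}} ≤ C ‖∇u‖_{L²}^p`. -/
theorem weighted_sobolev_estimate (n : ℕ) (hn : 3 ≤ n) (α τ p : ℝ)
    (hα0 : 0 < α) (hαn : α < n) (hτ0 : 0 < τ) (hτ : τ ≤ 1 + α / n)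
    (hp : p = 1 + (2 - 2 * τ + α) / ((n : ℝ) - 2)) :
    ∃ C : ℝ, 0 < C ∧ ∀ u : EuclideanSpace ℝ (Fin n) → ℂ,
      ContDiff ℝ (⊤ : ℕ∞) u → HasCompactSupport u →
      (∫ x, ‖x‖ ^ (-(2 * (n : ℝ) * τ) / (α + n)) * ‖u x‖ ^ (2 * (n : ℝ) * p / (α + n)))
          ^ ((α + n) / (2 * (n : ℝ) * p))
        ≤ C * (∫ x, ‖fderiv ℝ u x‖ ^ 2) ^ ((1 : ℝ) / 2) := by
  have hn3 : (3 : ℝ) ≤ n := by exact_mod_cast hn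
  have hn' : (0 : ℝ) < n - 2 := by linarith
  have hn0 : (0 : ℝ) < n := by linarith
  have hαn0 : 0 < α + n := by positivity
  obtain ⟨a, ha⟩ : ∃ a, a = 2 * (n : ℝ) * τ / (α + n) := ⟨_, rfl⟩
  obtain ⟨q, hq⟩ : ∃ q, q = 2 * (n : ℝ) * p / (α + n) := ⟨_, rfl⟩
  have ha0 : 0 < a := by rw [ha]; positivity
  have ha2 : a ≤ 2 := by
    rw [ha, div_le_iff₀ hαn0]
    have := mul_le_mul_of_nonneg_left hτ hn0.le
    have e : (n : ℝ) * (1 + α / n) = n + α := by field_simp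
    linarith
  have hqa : q = a + 2 * n / ((n : ℝ) - 2) * (1 - a / 2) := by
    rw [hq, ha, hp]
    field_simp
    ring
  have hq0 : 0 < q := by
    have : 0 ≤ 2 * n / ((n : ℝ) - 2) * (1 - a / 2) := mul_nonneg (by positivity) (by linarith)
    linarith
  have e1 : -(2 * (n : ℝ) * τ) / (α + n) = -a := by rw [ha, neg_div]
  have e2 : (α + n) / (2 * (n : ℝ) * p) = q⁻¹ := by rw [hq, inv_div]
  rw [e1, e2, ← hq]
  obtain ⟨S, hS0, hS⟩ := exists_lintegral_rpow_le hn
  have hb : 0 ≤ 1 - a / 2 := by linarith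
  obtain ⟨M, hM⟩ : ∃ M, M = (4 / ((n : ℝ) - 2) ^ 2) ^ (a / 2) * S ^ (1 - a / 2) := ⟨_, rfl⟩
  have hM0 : 0 ≤ M := by rw [hM]; positivity
  refine ⟨M ^ q⁻¹ + 1, by positivity, fun u hu hc => ?_⟩
  have hu1 : ContDiff ℝ 1 u := hu.of_le (by exact_mod_cast le_top)
  have hum : Measurable u := hu1.continuous.measurable
  have hH := lintegral_sq_div_norm_sq_le hn hu1 hc
  have hS := hS u hu1 hc
  have hD0 : 0 ≤ ∫ x, ‖fderiv ℝ u x‖ ^ 2 := integral_nonneg fun x => by positivity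
  generalize ∫ x, ‖fderiv ℝ u x‖ ^ 2 = D at *
  have hX : ∫ x, ‖x‖ ^ (-a) * ‖u x‖ ^ q ≤ M * D ^ (q / 2) := by
    rw [integral_eq_lintegral_of_nonneg_ae (.of_forall fun x => by positivity)
      (by fun_prop)]
    refine ENNReal.toReal_le_of_le_ofReal (by positivity) ?_
    calc ∫⁻ x, ENNReal.ofReal (‖x‖ ^ (-a) * ‖u x‖ ^ q)
        = ∫⁻ x, ENNReal.ofReal (‖u x‖ ^ 2 / ‖x‖ ^ 2) ^ (a / 2) *
            ENNReal.ofReal (‖u x‖ ^ (2 * n / ((n : ℝ) - 2))) ^ (1 - a / 2) := by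
          refine lintegral_congr fun x => ?_
          rw [ENNReal.ofReal_rpow_of_nonneg (by positivity) (by positivity),
            ENNReal.ofReal_rpow_of_nonneg (by positivity) hb,
            ← ENNReal.ofReal_mul (by positivity), ← Real.rpow_mul (norm_nonneg _),
            Real.div_rpow (by positivity) (by positivity), ← Real.rpow_natCast,
            ← Real.rpow_natCast, ← Real.rpow_mul (norm_nonneg _), ← Real.rpow_mul (norm_nonneg _),
            Real.rpow_neg (norm_nonneg _), hqa,
            Real.rpow_add_of_nonneg (norm_nonneg _) ha0.le (by positivity),
            show ((2 : ℕ) : ℝ) * (a / 2) = a by push_cast; ring]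
          congr 1
          ring
      _ ≤ (∫⁻ x, ENNReal.ofReal (‖u x‖ ^ 2 / ‖x‖ ^ 2)) ^ (a / 2) *
            (∫⁻ x, ENNReal.ofReal (‖u x‖ ^ (2 * n / ((n : ℝ) - 2)))) ^ (1 - a / 2) :=
          ENNReal.lintegral_mul_norm_pow_le (by fun_prop) (by fun_prop) (by positivity) hb (by ring)
      _ ≤ ENNReal.ofReal (4 / ((n : ℝ) - 2) ^ 2 * D) ^ (a / 2) *
            ENNReal.ofReal (S * D ^ (n / ((n : ℝ) - 2))) ^ (1 - a / 2) := by gcongr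
      _ = ENNReal.ofReal (M * D ^ (q / 2)) := by
          rw [ENNReal.ofReal_rpow_of_nonneg (by positivity) (by positivity),
            ENNReal.ofReal_rpow_of_nonneg (by positivity) hb,
            ← ENNReal.ofReal_mul (by positivity), Real.mul_rpow (by positivity) hD0,
            Real.mul_rpow hS0 (by positivity), ← Real.rpow_mul hD0,
            show q / 2 = a / 2 + n / ((n : ℝ) - 2) * (1 - a / 2) by rw [hqa]; ring,
            Real.rpow_add_of_nonneg hD0 (by positivity) (by positivity), hM]
          congr 1
          ring
  calc (∫ x, ‖x‖ ^ (-a) * ‖u x‖ ^ q) ^ q⁻¹ ≤ (M * D ^ (q / 2)) ^ q⁻¹ :=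
        Real.rpow_le_rpow (integral_nonneg fun x => by positivity) hX (by positivity)
    _ = M ^ q⁻¹ * D ^ ((1 : ℝ) / 2) := by
        rw [Real.mul_rpow hM0 (by positivity), ← Real.rpow_mul hD0]
        congr 2
        field_simp
    _ ≤ (M ^ q⁻¹ + 1) * D ^ ((1 : ℝ) / 2) := by
        gcongr
        linarith
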